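/- arXiv:1901.09081 — 5 statements merged into one kernel-verified Lean document; each statement's English description precedes it below -/
import Mathlib

section
/- Let K be a surface simplex in ℝ^d and let M ∈ ℝ^{d×d} be symmetric positive definite. Then |K|_M ≥ a_{K,M}^{d−1} / ((d−1)^{(d−1)/2} (d−1)!), where a_{K,M} is the minimum altitude of K with respect to M. -/
open Matrix MeasureTheory

/-- A point of the Kuhn simplex `1 ≥ t₀ ≥ t₁ ≥ … ≥ 0` parametrizes a point of the convex hull
of `y` along the edge path `y₀, y₁, …`. -/
theorem add_sum_smul_sub_mem_convexHull {E : Type*} [AddCommGroup E] [Module ℝ E] {n : ℕ}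
    (y : Fin (n + 1) → E) {t : Fin n → ℝ} (ht : Antitone t) (ht₁ : t ∈ Set.Icc 0 1) :
    y 0 + ∑ k : Fin n, t k • (y k.succ - y k.castSucc) ∈ convexHull ℝ (Set.range y) := by
  let T : Fin (n + 1) → ℝ := Fin.cons 1 t
  let U : Fin (n + 1) → ℝ := Fin.snoc t 0
  have hT (z : Fin (n + 1) → E) : ∑ i, T i • z i = z 0 + ∑ k : Fin n, t k • z k.succ := by
    simp [T, Fin.sum_univ_succ]
  have hU (z : Fin (n + 1) → E) : ∑ i, U i • z i = ∑ k : Fin n, t k • z k.castSucc := by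
    simp [U, Fin.sum_univ_castSucc]
  have hsum : ∑ i, (T i - U i) = 1 := by
    rw [Finset.sum_sub_distrib]
    simp [T, U, Fin.sum_univ_succ (Fin.cons 1 t : Fin (n + 1) → ℝ),
      Fin.sum_univ_castSucc (Fin.snoc t 0 : Fin (n + 1) → ℝ)]
  have hnonneg (i : Fin (n + 1)) : 0 ≤ T i - U i := by
    rw [sub_nonneg]
    induction i using Fin.lastCases with
    | last =>
      simp only [U, Fin.snoc_last]
      refine Fin.cases ?_ (fun k => ?_) (Fin.last n)
      · simp [T]
      · simpa [T] using ht₁.1 k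
    | cast j =>
      simp only [U, Fin.snoc_castSucc]
      cases n with
      | zero => exact j.elim0
      | succ m =>
        induction j using Fin.cases with
        | zero => simpa [T] using ht₁.2 0
        | succ k =>
          rw [Fin.castSucc_succ]
          simpa [T] using ht (Fin.castSucc_lt_succ (i := k)).le
  have hrepr : y 0 + ∑ k : Fin n, t k • (y k.succ - y k.castSucc) =
      ∑ i, (T i - U i) • y i := by
    simp_rw [sub_smul, smul_sub, Finset.sum_sub_distrib, hT, hU, add_sub_assoc]
  rw [hrepr]
  exact (convex_convexHull ℝ _).sum_mem (fun i _ => hnonneg i) hsum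
    fun i _ => subset_convexHull ℝ _ ⟨i, rfl⟩

/-- The Kuhn simplex has volume at least `1 / n!`. -/
theorem one_le_factorial_mul_volume_antitone (n : ℕ) :
    1 ≤ (n.factorial : ENNReal) *
      volume {t : Fin n → ℝ | Antitone t ∧ t ∈ Set.Icc (0 : Fin n → ℝ) 1} := by
  set S := {t : Fin n → ℝ | Antitone t ∧ t ∈ Set.Icc (0 : Fin n → ℝ) 1}
  let e (σ : Equiv.Perm (Fin n)) := MeasurableEquiv.piCongrLeft (fun _ : Fin n => ℝ) σ
  have he (σ : Equiv.Perm (Fin n)) (t : Fin n → ℝ) (i : Fin n) : e σ t i = t (σ.symm i) := by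
    simp [e, MeasurableEquiv.coe_piCongrLeft, Equiv.piCongrLeft_apply]
  have hcover : Set.Icc (0 : Fin n → ℝ) 1 ⊆ ⋃ σ : Equiv.Perm (Fin n), e σ ⁻¹' S := by
    intro t ht
    have hmono := Tuple.monotone_sort (fun i => -t i)
    refine Set.mem_iUnion.2 ⟨(Tuple.sort fun i => -t i).symm, ?_, ?_, ?_⟩
    · intro i j hij
      simpa [he] using hmono hij
    · intro i
      simpa [he] using ht.1 _
    · intro i
      simpa [he] using ht.2 _
  calc (1 : ENNReal) = volume (Set.Icc (0 : Fin n → ℝ) 1) := by simp [Real.volume_Icc_pi]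
    _ ≤ ∑ σ : Equiv.Perm (Fin n), volume (e σ ⁻¹' S) :=
      (measure_mono hcover).trans (measure_iUnion_fintype_le _ _)
    _ = ∑ _σ : Equiv.Perm (Fin n), volume S := by
      refine Finset.sum_congr rfl fun σ _ => ?_
      exact (volume_measurePreserving_piCongrLeft (fun _ : Fin n => ℝ) σ).measure_preimage_equiv S
    _ = n.factorial * volume S := by simp [Fintype.card_perm]

/-- If the simplex with vertices `y` has Gram–Schmidt heights at least `a` along its edge path,
then its Hausdorff measure is at least `a ^ n / n!`. -/
theorem ofReal_pow_div_factorial_le_hausdorffMeasure_convexHull {E : Type*}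
    [NormedAddCommGroup E] [InnerProductSpace ℝ E] [MeasurableSpace E] [BorelSpace E] {n : ℕ}
    (y : Fin (n + 1) → E) {a : ℝ} (ha : 0 ≤ a)
    (hy : ∀ k : Fin n, a ≤
      ‖InnerProductSpace.gramSchmidt ℝ (fun k : Fin n => y k.succ - y k.castSucc) k‖) :
    ENNReal.ofReal (a ^ n / n.factorial) ≤ μH[(n : ℝ)] (convexHull ℝ (Set.range y)) := by
  set w : Fin n → E := fun k => y k.succ - y k.castSucc
  set g := InnerProductSpace.gramSchmidt ℝ w
  let e : Fin n → E := InnerProductSpace.gramSchmidtNormed ℝ w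
  let L : E → Fin n → ℝ := fun z k => inner ℝ (e k) z
  have he (k : Fin n) : ‖e k‖ ≤ 1 := by
    by_cases h : e k = 0
    · simp [h]
    · exact (InnerProductSpace.gramSchmidtNormed_unit_length' h).le
  have hL : LipschitzWith 1 L := by
    refine LipschitzWith.of_dist_le_mul fun u v => ?_
    rw [NNReal.coe_one, one_mul, dist_pi_le_iff dist_nonneg]
    intro k
    rw [Real.dist_eq, ← inner_sub_right, dist_eq_norm]
    exact (abs_real_inner_le_norm _ _).trans (mul_le_of_le_one_left (norm_nonneg _) (he k))
  let A : Matrix (Fin n) (Fin n) ℝ := Matrix.of fun k j => inner ℝ (e k) (w j)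
  have hA : A.BlockTriangular id := by
    intro k j hjk
    change inner ℝ (e k) (w j) = 0
    simp only [e, InnerProductSpace.gramSchmidtNormed, real_inner_smul_left]
    rw [InnerProductSpace.gramSchmidt_inv_triangular ℝ w (show j < k from hjk), mul_zero]
  have hdiag (k : Fin n) : A k k = ‖g k‖ := by
    have hinner : inner ℝ (g k) (w k) = ‖g k‖ ^ 2 := by
      conv_lhs => rw [InnerProductSpace.gramSchmidt_def'' ℝ w k]
      rw [inner_add_right, inner_sum, Finset.sum_eq_zero, add_zero, real_inner_self_eq_norm_sq]
      intro i hi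
      rw [real_inner_smul_right,
        InnerProductSpace.gramSchmidt_orthogonal ℝ w (Finset.mem_Iio.1 hi).ne', mul_zero]
    change inner ℝ ((‖g k‖ : ℝ)⁻¹ • g k) (w k) = ‖g k‖
    rw [real_inner_smul_left, hinner]
    by_cases h : ‖g k‖ = 0
    · simp [h]
    · field_simp
  have hdet : a ^ n ≤ |A.det| := by
    rw [Matrix.det_of_isUpperTriangular hA, Finset.abs_prod]
    calc a ^ n = ∏ _k : Fin n, a := by simp
      _ ≤ _ := Finset.prod_le_prod (fun _ _ => ha) fun k _ => by
        rw [hdiag, abs_norm]; exact hy k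
  set S := {t : Fin n → ℝ | Antitone t ∧ t ∈ Set.Icc (0 : Fin n → ℝ) 1}
  have hsub : (fun v => L (y 0) + v) '' (Matrix.toLin' A '' S) ⊆
      L '' convexHull ℝ (Set.range y) := by
    rintro _ ⟨_, ⟨t, ht, rfl⟩, rfl⟩
    refine ⟨_, add_sum_smul_sub_mem_convexHull y ht.1 ht.2, ?_⟩
    ext k
    simp [L, A, w, inner_add_right, inner_sum, real_inner_smul_right, Matrix.mulVec, dotProduct,
      mul_comm]
  have hS : ENNReal.ofReal (1 / n.factorial) ≤ volume S := by
    rw [ENNReal.ofReal_div_of_pos (by positivity), ENNReal.ofReal_one, ENNReal.ofReal_natCast]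
    exact ENNReal.div_le_of_le_mul' (one_le_factorial_mul_volume_antitone n)
  calc ENNReal.ofReal (a ^ n / n.factorial)
      = ENNReal.ofReal (a ^ n) * ENNReal.ofReal (1 / n.factorial) := by
        rw [← ENNReal.ofReal_mul (by positivity), mul_one_div]
    _ ≤ ENNReal.ofReal |A.det| * volume S := by gcongr
    _ = volume ((fun v => L (y 0) + v) '' (Matrix.toLin' A '' S)) := by
      rw [Set.image_add_left, measure_preimage_add, Measure.addHaar_image_linearMap,
        LinearMap.det_toLin']
    _ ≤ volume (L '' convexHull ℝ (Set.range y)) := measure_mono hsub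
    _ = μH[(n : ℝ)] (L '' convexHull ℝ (Set.range y)) := by
      rw [← hausdorffMeasure_pi_real, Fintype.card_fin]
    _ ≤ μH[(n : ℝ)] (convexHull ℝ (Set.range y)) := by
      simpa using hL.hausdorffMeasure_image_le (Nat.cast_nonneg n) (convexHull ℝ (Set.range y))

/-- The Gram–Schmidt heights along the edge path of `y` dominate the altitudes. -/
theorem infDist_affineSpan_le_norm_gramSchmidt {E : Type*}
    [NormedAddCommGroup E] [InnerProductSpace ℝ E] {n : ℕ} (y : Fin (n + 1) → E) (k : Fin n) :
    Metric.infDist (y k.succ) (affineSpan ℝ (y '' {j | j ≠ k.succ})) ≤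
      ‖InnerProductSpace.gramSchmidt ℝ (fun k : Fin n => y k.succ - y k.castSucc) k‖ := by
  set w : Fin n → E := fun k => y k.succ - y k.castSucc
  set Q := affineSpan ℝ (y '' {j | j ≠ k.succ})
  have hmem {j : Fin (n + 1)} (hj : j ≠ k.succ) : y j ∈ Q :=
    subset_affineSpan ℝ _ ⟨j, hj, rfl⟩
  have hk : y k.castSucc ∈ Q := hmem (Fin.castSucc_lt_succ (i := k)).ne
  have hspan : Submodule.span ℝ (w '' Set.Iio k) ≤ Q.direction := by
    rw [Submodule.span_le]
    rintro _ ⟨j, hj, rfl⟩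
    refine AffineSubspace.vsub_mem_direction (hmem ?_) (hmem ?_)
    · exact fun h => (Set.mem_Iio.1 hj).ne (Fin.succ_injective _ h)
    · exact ((Fin.castSucc_lt_succ (i := j)).trans (Fin.succ_lt_succ_iff.2 hj)).ne
  set v := w k - InnerProductSpace.gramSchmidt ℝ w k with hv
  have hvQ : v ∈ Q.direction := by
    apply hspan
    rw [← InnerProductSpace.span_gramSchmidt_Iio ℝ w k, hv, InnerProductSpace.gramSchmidt_def,
      sub_sub_cancel]
    refine Submodule.sum_mem _ fun i hi => ?_
    rw [Submodule.starProjection_singleton]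
    exact Submodule.smul_mem _ _ (Submodule.subset_span ⟨i, Finset.mem_Iio.1 hi, rfl⟩)
  refine (Metric.infDist_le_dist_of_mem (AffineSubspace.vadd_mem_of_mem_direction hvQ hk)).trans ?_
  rw [dist_eq_norm]
  apply le_of_eq
  congr 1
  simp only [hv, w, vadd_eq_add]
  abel

/-- For a surface simplex `K` in `ℝ^d` (here `d = n+1`) and a symmetric
positive definite `M ∈ ℝ^{d×d}` with positive definite square root `R` (`R * R = M`):
`|K|_M ≥ a_{K,M}^{d−1} / ((d−1)^{(d−1)/2} (d−1)!)`, where `|K|_M` is the `(d-1)`-dimensional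
Hausdorff measure of `M^{1/2} K` and `a_{K,M}` is the minimum altitude of `K` with respect
to `M`, i.e. the minimum over `i` of the distance from `M^{1/2} x_i` to the affine span of
the remaining points `M^{1/2} x_j`, `j ≠ i`. -/
theorem area_ge_min_altitude_pow (n : ℕ) (hn : 1 ≤ n)
    (x : Fin (n + 1) → EuclideanSpace ℝ (Fin (n + 1)))
    (hx : AffineIndependent ℝ x)
    (M R : Matrix (Fin (n + 1)) (Fin (n + 1)) ℝ)
    (hM : M.PosDef) (hR : R.PosDef) (hRM : R * R = M)
    (a : ℝ)
    (ha : a = ⨅ i : Fin (n + 1),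
      Metric.infDist (Matrix.toEuclideanLin R (x i))
        ((affineSpan ℝ ((fun j => Matrix.toEuclideanLin R (x j)) '' {j | j ≠ i}) :
          AffineSubspace ℝ (EuclideanSpace ℝ (Fin (n + 1)))) : Set (EuclideanSpace ℝ (Fin (n + 1))))) :
    ENNReal.ofReal (a ^ n / ((n : ℝ) ^ ((n : ℝ) / 2) * (n.factorial : ℝ)))
      ≤ μH[(n : ℝ)] (⇑(Matrix.toEuclideanLin R) '' convexHull ℝ (Set.range x)) := by
  set y : Fin (n + 1) → EuclideanSpace ℝ (Fin (n + 1)) := fun i => Matrix.toEuclideanLin R (x i)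
  have ha₀ : 0 ≤ a := ha ▸ Real.iInf_nonneg fun i => Metric.infDist_nonneg
  have hle (i : Fin (n + 1)) : a ≤ Metric.infDist (y i) (affineSpan ℝ (y '' {j | j ≠ i})) :=
    ha ▸ ciInf_le (Set.finite_range _).bddBelow i
  have himage : ⇑(Matrix.toEuclideanLin R) '' convexHull ℝ (Set.range x) =
      convexHull ℝ (Set.range y) := by
    rw [LinearMap.image_convexHull, ← Set.range_comp]
    rfl
  have hpow : (1 : ℝ) ≤ (n : ℝ) ^ ((n : ℝ) / 2) :=
    Real.one_le_rpow (by exact_mod_cast hn) (by positivity)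
  rw [himage]
  refine le_trans (ENNReal.ofReal_le_ofReal ?_)
    (ofReal_pow_div_factorial_le_hausdorffMeasure_convexHull y ha₀ fun k =>
      (hle k.succ).trans (infDist_affineSpan_le_norm_gramSchmidt y k))
  gcongr
  exact le_mul_of_one_le_left (by positivity) hpow
end

section
/- Let K be a surface simplex in ℝ^d with edge matrix E_K, let K̂ be an equilateral reference simplex in ℝ^{d−1} with edge matrix Ê and altitude â, let F_K' = E_K Ê⁻¹, and let M ∈ ℝ^{d×d} be symmetric positive definite. Then â²/a_{K,M}² ≤ ‖((F_K')ᵀ M F_K')⁻¹‖ ≤ (d−1)² â²/a_{K,M}², where ‖·‖ is the spectral (operator 2-) norm and a_{K,M} is the minimum altitude of K with respect to M. -/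
open Matrix MeasureTheory

section Altitude

variable {ι V : Type*} [Fintype ι] [DecidableEq ι] [NormedAddCommGroup V] [NormedSpace ℝ V]

/-- A vector `∑ j, c j • f j` with `∑ j, c j = 0` and `c i = 1` joins the affine span of the
other points to `f i`, so it is at least as long as the altitude. -/
theorem infDist_affineSpan_ne_le_norm_sum (f : ι → V) (i : ι) {c : ι → ℝ}
    (hc : ∑ j, c j = 0) (hci : c i = 1) :
    Metric.infDist (f i) (affineSpan ℝ (f '' {j | j ≠ i}) : Set V) ≤ ‖∑ j, c j • f j‖ := by
  have hw : ∑ j, (Pi.single i 1 - c : ι → ℝ) j = 1 := by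
    simp [Finset.sum_sub_distrib, hc]
  have hmem := affineCombination_mem_affineSpan_image (k := ℝ) (s' := {j | j ≠ i}) hw
    (by
      intro j _ hj
      obtain rfl : j = i := by simpa using hj
      simp [hci]) f
  rw [Finset.affineCombination_eq_linear_combination _ _ _ hw] at hmem
  refine (Metric.infDist_le_dist_of_mem hmem).trans_eq ?_
  rw [dist_eq_norm]
  congr 1
  simp [sub_smul, Finset.sum_sub_distrib, Pi.single_apply, ite_smul]

/-- The altitude over `f i` is bounded below by any lower bound for the lengths of the vectors
`∑ j, c j • f j` with `∑ j, c j = 0` and `c i = 1`. -/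
theorem le_infDist_affineSpan_ne [Nontrivial ι] (f : ι → V) (i : ι) {r : ℝ}
    (h : ∀ c : ι → ℝ, ∑ j, c j = 0 → c i = 1 → r ≤ ‖∑ j, c j • f j‖) :
    r ≤ Metric.infDist (f i) (affineSpan ℝ (f '' {j | j ≠ i}) : Set V) := by
  obtain ⟨k, hk⟩ := exists_ne i
  refine (Metric.le_infDist ⟨f k, subset_affineSpan ℝ _ (Set.mem_image_of_mem f hk)⟩).2 ?_
  intro p hp
  obtain ⟨s, w, hs, hw, rfl⟩ := eq_affineCombination_of_mem_affineSpan_image hp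
  have his : i ∉ s := fun hi => hs hi rfl
  rw [Finset.affineCombination_eq_linear_combination _ _ _ hw, dist_eq_norm]
  refine (h (fun j => (if j = i then 1 else 0) - if j ∈ s then w j else 0)
    (by simp [Finset.sum_sub_distrib, Finset.sum_ite_mem, hw]) (by simp [his])).trans_eq ?_
  simp [sub_smul, Finset.sum_sub_distrib, ite_smul, Finset.sum_ite_mem]

/-- Each coefficient of `∑ j, c j • f j` with `∑ j, c j = 0` is controlled by the altitude. -/
theorem abs_mul_infDist_affineSpan_ne_le (f : ι → V) (i : ι) {c : ι → ℝ}
    (hc : ∑ j, c j = 0) :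
    |c i| * Metric.infDist (f i) (affineSpan ℝ (f '' {j | j ≠ i}) : Set V)
      ≤ ‖∑ j, c j • f j‖ := by
  rcases eq_or_ne (c i) 0 with h0 | h0
  · simp [h0]
  have h := infDist_affineSpan_ne_le_norm_sum f i (c := fun j => (c i)⁻¹ * c j)
    (by rw [← Finset.mul_sum, hc, mul_zero]) (inv_mul_cancel₀ h0)
  simp_rw [mul_smul] at h
  rw [← Finset.smul_sum, norm_smul, norm_inv, Real.norm_eq_abs] at h
  rwa [← le_inv_mul_iff₀ (abs_pos.2 h0)]

end Altitude

section Equilateral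

variable {ι V : Type*} [Fintype ι] [DecidableEq ι] [NormedAddCommGroup V] [InnerProductSpace ℝ V]

theorem norm_sq_sum_smul_of_equilateral {f : ι → V} {h : ℝ}
    (hf : ∀ i j, i ≠ j → dist (f i) (f j) = h) {c : ι → ℝ} (hc : ∑ j, c j = 0) :
    ‖∑ j, c j • f j‖ ^ 2 = h ^ 2 / 2 * ∑ j, c j ^ 2 := by
  rw [← real_inner_self_eq_norm_sq, inner_sum_smul_sum_smul_of_sum_eq_zero f hc f hc]
  have hterm : ∀ i j, c i * c j * (‖f i - f j‖ * ‖f i - f j‖)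
      = h ^ 2 * (c i * c j) - if i = j then h ^ 2 * c i ^ 2 else 0 := by
    intro i j
    split_ifs with hij
    · subst hij
      simp
      ring
    · rw [← dist_eq_norm, hf i j hij]
      ring
  simp_rw [hterm, Finset.sum_sub_distrib, Finset.sum_ite_eq, Finset.mem_univ, if_true,
    ← Finset.mul_sum, hc]
  simp
  ring

/-- Lower bound for the altitudes of an equilateral simplex. -/
theorem card_mul_sq_edge_le_of_equilateral [Nontrivial ι] {f : ι → V} {h : ℝ}
    (hf : ∀ i j, i ≠ j → dist (f i) (f j) = h) (i : ι) :
    Fintype.card ι * (h ^ 2 / 2) ≤ (Fintype.card ι - 1 : ℝ) *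
      Metric.infDist (f i) (affineSpan ℝ (f '' {j | j ≠ i}) : Set V) ^ 2 := by
  have hcard : (0 : ℝ) < Fintype.card ι - 1 := by
    rw [sub_pos]
    exact_mod_cast Fintype.one_lt_card
  rw [← div_le_iff₀' hcard, ← Real.sqrt_le_left Metric.infDist_nonneg]
  refine le_infDist_affineSpan_ne f i fun c hc hci => ?_
  rw [Real.sqrt_le_left (norm_nonneg _), norm_sq_sum_smul_of_equilateral hf hc,
    div_le_iff₀' hcard]
  have hsum := Finset.add_sum_erase Finset.univ c (Finset.mem_univ i)
  have hsq := Finset.add_sum_erase Finset.univ (fun j => c j ^ 2) (Finset.mem_univ i)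
  have hcs := sq_sum_le_card_mul_sum_sq (s := Finset.univ.erase i) (f := c)
  rw [Finset.card_erase_of_mem (Finset.mem_univ i), Finset.card_univ,
    Nat.cast_pred Fintype.card_pos] at hcs
  rw [hc, hci] at hsum
  have hrest : ∑ j ∈ Finset.univ.erase i, c j = -1 := by linarith
  rw [hrest] at hcs
  simp only [hci] at hsq
  rw [← hsq]
  nlinarith [mul_le_mul_of_nonneg_left hcs (by positivity : 0 ≤ h ^ 2 / 2)]

end Equilateral

section InverseGram

variable {V W : Type*} [NormedAddCommGroup V] [InnerProductSpace ℝ V]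
  [NormedAddCommGroup W] [InnerProductSpace ℝ W] {B : V →ₗ[ℝ] W} {S : V →L[ℝ] V}

/-- If `S` inverts the Gram operator of `B`, then `‖S‖` bounds `‖v‖² / ‖B v‖²`. -/
theorem norm_sq_le_norm_inverse_gram_mul
    (hS : ∀ v w, inner ℝ (B v) (B (S w)) = inner ℝ v w) (v : V) :
    ‖v‖ ^ 2 ≤ ‖S‖ * ‖B v‖ ^ 2 := by
  rcases eq_or_ne v 0 with rfl | hv
  · simp
  have hvpos : 0 < ‖v‖ ^ 2 := by positivity
  have h1 : ‖v‖ ^ 2 ≤ ‖B v‖ * ‖B (S v)‖ := by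
    rw [← real_inner_self_eq_norm_sq, ← hS v v]
    exact real_inner_le_norm _ _
  have h2 : ‖B (S v)‖ ^ 2 ≤ ‖S‖ * ‖v‖ ^ 2 := by
    rw [← real_inner_self_eq_norm_sq, hS]
    refine (real_inner_le_norm _ _).trans ?_
    nlinarith [mul_le_mul_of_nonneg_right (S.le_opNorm v) (norm_nonneg v)]
  have h3 : (‖v‖ ^ 2) ^ 2 ≤ ‖B v‖ ^ 2 * ‖B (S v)‖ ^ 2 := by
    rw [← mul_pow]
    gcongr
  have h4 : (‖v‖ ^ 2) * ‖v‖ ^ 2 ≤ (‖S‖ * ‖B v‖ ^ 2) * ‖v‖ ^ 2 := by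
    nlinarith [mul_le_mul_of_nonneg_left h2 (sq_nonneg ‖B v‖)]
  exact le_of_mul_le_mul_right h4 hvpos

/-- If `S` inverts the Gram operator of `B`, then any bound for `‖v‖² / ‖B v‖²` bounds `‖S‖`. -/
theorem norm_inverse_gram_le
    (hS : ∀ v w, inner ℝ (B v) (B (S w)) = inner ℝ v w) {k : ℝ} (hk : 0 ≤ k)
    (hB : ∀ v, ‖v‖ ^ 2 ≤ k * ‖B v‖ ^ 2) : ‖S‖ ≤ k := by
  refine S.opNorm_le_bound hk fun w => ?_
  have h := hB (S w)
  rw [← real_inner_self_eq_norm_sq (B (S w)), hS] at h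
  rcases (norm_nonneg (S w)).eq_or_lt with h0 | hpos
  · rw [← h0]
    positivity
  · refine le_of_mul_le_mul_left ?_ hpos
    nlinarith [mul_le_mul_of_nonneg_left (real_inner_le_norm (S w) w) hk]

end InverseGram

theorem sum_smul_eq_edgeMatrix_mulVec {m n : ℕ} {x : Fin (n + 1) → EuclideanSpace ℝ (Fin m)}
    {E : Matrix (Fin m) (Fin n) ℝ} (hE : ∀ i j, E i j = x j.succ i - x 0 i)
    {c : Fin (n + 1) → ℝ} (hc : ∑ j, c j = 0) :
    ∑ j, c j • x j = WithLp.toLp 2 (E *ᵥ fun j => c j.succ) := by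
  rw [Fin.sum_univ_succ] at hc ⊢
  have h0 : c 0 = -∑ j : Fin n, c j.succ := by linarith
  ext i
  simp only [h0, Matrix.mulVec, dotProduct, hE, sub_mul, Finset.sum_sub_distrib, PiLp.add_apply,
    PiLp.smul_apply, smul_eq_mul, WithLp.ofLp_sum, Finset.sum_apply, WithLp.ofLp_smul,
    Pi.smul_apply, ← Finset.mul_sum]
  simp only [mul_comm (c _)]
  ring

theorem edgeMatrix_mulVec_injective {m n : ℕ} {x : Fin (n + 1) → EuclideanSpace ℝ (Fin m)}
    (hx : AffineIndependent ℝ x) {E : Matrix (Fin m) (Fin n) ℝ}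
    (hE : ∀ i j, E i j = x j.succ i - x 0 i) : Function.Injective E.mulVec := by
  refine (injective_iff_map_eq_zero E.mulVecLin).2 fun u hu => ?_
  have hc : ∑ j, (Fin.cons (-∑ j, u j) u : Fin (n + 1) → ℝ) j = 0 := by
    simp [Fin.sum_univ_succ]
  have hsum := sum_smul_eq_edgeMatrix_mulVec hE hc
  simp only [Fin.cons_succ] at hsum
  rw [show E *ᵥ u = 0 from hu] at hsum
  ext j
  simpa using affineIndependent_iff.1 hx Finset.univ _ hc hsum j.succ (Finset.mem_univ _)

/-- For a surface simplex `K` in `ℝ^d` (here `d = n+1`) with edge matrix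
`E_K`, an equilateral reference simplex `K̂` in `ℝ^{d-1}` with invertible edge matrix `Ê`
and altitude `â`, `F_K' = E_K Ê⁻¹`, and a symmetric positive definite `M` with positive
definite square root `R` (`R * R = M`):
`â²/a_{K,M}² ≤ ‖((F_K')ᵀ M F_K')⁻¹‖ ≤ (d−1)² â²/a_{K,M}²`, where `‖·‖` is the spectral
(operator 2-) norm and `a_{K,M}` is the minimum altitude of `K` with respect to `M`. -/
theorem spectral_norm_inv_bounds (n : ℕ) (hn : 1 ≤ n)
    (x : Fin (n + 1) → EuclideanSpace ℝ (Fin (n + 1)))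
    (ξ : Fin (n + 1) → EuclideanSpace ℝ (Fin n))
    (hx : AffineIndependent ℝ x) (hξ : AffineIndependent ℝ ξ)
    (hequi : ∀ i j k l : Fin (n + 1), i ≠ j → k ≠ l → dist (ξ i) (ξ j) = dist (ξ k) (ξ l))
    (ahat : ℝ)
    (hahat : ∀ i : Fin (n + 1),
      Metric.infDist (ξ i)
        ((affineSpan ℝ (ξ '' {j | j ≠ i}) : AffineSubspace ℝ (EuclideanSpace ℝ (Fin n))) :
          Set (EuclideanSpace ℝ (Fin n))) = ahat)
    (E : Matrix (Fin (n + 1)) (Fin n) ℝ)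
    (hE : ∀ i j, E i j = x j.succ i - x 0 i)
    (Ehat : Matrix (Fin n) (Fin n) ℝ)
    (hEhat : ∀ i j, Ehat i j = ξ j.succ i - ξ 0 i)
    (hEhatUnit : IsUnit Ehat.det)
    (F : Matrix (Fin (n + 1)) (Fin n) ℝ) (hF : F = E * Ehat⁻¹)
    (M R : Matrix (Fin (n + 1)) (Fin (n + 1)) ℝ)
    (hM : M.PosDef) (hR : R.PosDef) (hRM : R * R = M)
    (a : ℝ)
    (ha : a = ⨅ i : Fin (n + 1),
      Metric.infDist (Matrix.toEuclideanLin R (x i))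
        ((affineSpan ℝ ((fun j => Matrix.toEuclideanLin R (x j)) '' {j | j ≠ i}) :
          AffineSubspace ℝ (EuclideanSpace ℝ (Fin (n + 1)))) :
          Set (EuclideanSpace ℝ (Fin (n + 1))))) :
    ahat ^ 2 / a ^ 2 ≤ ‖Matrix.toEuclideanCLM (𝕜 := ℝ) ((Fᵀ * M * F)⁻¹)‖ ∧
      ‖Matrix.toEuclideanCLM (𝕜 := ℝ) ((Fᵀ * M * F)⁻¹)‖ ≤ (n : ℝ) ^ 2 * ahat ^ 2 / a ^ 2 := by
  have : Nontrivial (Fin (n + 1)) := Fin.nontrivial_iff_two_le.2 (by omega)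
  have hnpos : (0 : ℝ) < n := by exact_mod_cast hn
  set S := Matrix.toEuclideanCLM (𝕜 := ℝ) ((Fᵀ * M * F)⁻¹) with hSdef
  set B := Matrix.toEuclideanLin (R * F) with hBdef
  set y := fun j => Matrix.toEuclideanLin R (x j) with hydef
  set alt := fun i : Fin (n + 1) => Metric.infDist (y i)
    (affineSpan ℝ (y '' {j | j ≠ i}) : Set (EuclideanSpace ℝ (Fin (n + 1))))
  have hFE : F * Ehat = E := by rw [hF, Matrix.nonsing_inv_mul_cancel_right _ _ hEhatUnit]
  have hFinj : Function.Injective F.mulVec := by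
    intro u v huv
    have huv' : E *ᵥ (Ehat⁻¹ *ᵥ u) = E *ᵥ (Ehat⁻¹ *ᵥ v) := by
      simpa only [Matrix.mulVec_mulVec, ← hF] using huv
    have h := congrArg Ehat.mulVec (edgeMatrix_mulVec_injective hx hE huv')
    simpa [Matrix.mulVec_mulVec, Matrix.mul_nonsing_inv _ hEhatUnit] using h
  have hgram : IsUnit (Fᵀ * M * F).det := by
    rw [← Matrix.isUnit_iff_isUnit_det, ← Matrix.conjTranspose_eq_transpose_of_trivial]
    exact (hM.conjTranspose_mul_mul_same hFinj).isUnit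
  have hRt : Rᵀ = R := by
    rw [← Matrix.conjTranspose_eq_transpose_of_trivial]
    exact hR.isHermitian
  have hS : ∀ v w, inner ℝ (B v) (B (S w)) = inner ℝ v w := by
    intro v w
    have hgramEq : (R * F)ᵀ * (R * F) = Fᵀ * M * F := by
      rw [Matrix.transpose_mul, hRt, ← hRM]
      simp only [Matrix.mul_assoc]
    have hadj : inner ℝ (B v) (B (S w))
        = inner ℝ v (Matrix.toEuclideanLin ((R * F)ᵀ) (B (S w))) := by
      rw [← Matrix.conjTranspose_eq_transpose_of_trivial,
        Matrix.toEuclideanLin_conjTranspose_eq_adjoint, LinearMap.adjoint_inner_right]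
    rw [hadj]
    congr 1
    apply (WithLp.ofLp_injective 2)
    rw [Matrix.ofLp_toLpLin, hBdef, Matrix.ofLp_toLpLin, hSdef, Matrix.ofLp_toEuclideanCLM]
    simp only [Matrix.toLin'_apply, Matrix.mulVec_mulVec]
    rw [← Matrix.mul_assoc, hgramEq, Matrix.mul_nonsing_inv _ hgram, Matrix.one_mulVec]
  have hBsum : ∀ c : Fin (n + 1) → ℝ, ∑ j, c j = 0 → B (∑ j, c j • ξ j) = ∑ j, c j • y j := by
    intro c hc
    have hy : ∑ j, c j • y j = Matrix.toEuclideanLin R (∑ j, c j • x j) := by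
      simp [hydef, map_sum]
    rw [hy, sum_smul_eq_edgeMatrix_mulVec hEhat hc, sum_smul_eq_edgeMatrix_mulVec hE hc, hBdef,
      Matrix.toLpLin_toLp, Matrix.toLpLin_toLp]
    simp only [Matrix.toLin'_apply, Matrix.mulVec_mulVec, Matrix.mul_assoc, hFE]
  have hspan : ∀ v, ∃ c : Fin (n + 1) → ℝ, ∑ j, c j = 0 ∧ v = ∑ j, c j • ξ j := by
    intro v
    refine ⟨Fin.cons (-∑ j, (Ehat⁻¹ *ᵥ v.ofLp) j) (Ehat⁻¹ *ᵥ v.ofLp), ?_, ?_⟩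
    · simp [Fin.sum_univ_succ]
    · rw [sum_smul_eq_edgeMatrix_mulVec hEhat (by simp [Fin.sum_univ_succ])]
      simp only [Fin.cons_succ, Matrix.mulVec_mulVec]
      rw [Matrix.mul_nonsing_inv _ hEhatUnit, Matrix.one_mulVec]
  obtain ⟨h, hh⟩ : ∃ h, ∀ i j, i ≠ j → dist (ξ i) (ξ j) = h :=
    ⟨dist (ξ 0) (ξ 1), fun i j hij => hequi i j 0 1 hij (by simp; omega)⟩
  have hhpos : 0 < h := by
    obtain ⟨i, j, hij⟩ := exists_pair_ne (Fin (n + 1))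
    rw [← hh i j hij]
    exact dist_pos.2 (hξ.injective.ne hij)
  have hedge : (n + 1 : ℝ) * (h ^ 2 / 2) ≤ n * ahat ^ 2 := by
    have := card_mul_sq_edge_le_of_equilateral hh 0
    rw [hahat 0] at this
    simpa using this
  have hahat0 : 0 ≤ ahat := hahat 0 ▸ Metric.infDist_nonneg
  have hahatpos : 0 < ahat := by
    refine lt_of_le_of_ne hahat0 fun h0 => ?_
    rw [← h0] at hedge
    have : 0 < (n + 1 : ℝ) * (h ^ 2 / 2) := by positivity
    norm_num at hedge
    linarith
  obtain ⟨i₀, hi₀⟩ : ∃ i, alt i = a := by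
    rw [ha]
    exact exists_eq_ciInf_of_finite
  have hale : ∀ i, a ≤ alt i := by
    intro i
    rw [ha]
    exact ciInf_le (Set.finite_range _).bddBelow i
  have ha0 : 0 ≤ a := hi₀ ▸ Metric.infDist_nonneg
  have hSpos : 0 < ‖S‖ := by
    refine lt_of_le_of_ne (norm_nonneg _) fun h0 => ?_
    obtain ⟨i, j, hij⟩ := exists_pair_ne (Fin (n + 1))
    have := norm_sq_le_norm_inverse_gram_mul hS (ξ i - ξ j)
    rw [← h0, zero_mul, ← dist_eq_norm, hh i j hij] at this
    have : 0 < h ^ 2 := by positivity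
    linarith
  have hlow : ahat ^ 2 / ‖S‖ ≤ a ^ 2 := by
    rw [← Real.sqrt_le_left ha0, ← hi₀]
    refine le_infDist_affineSpan_ne y i₀ fun c hc hci => ?_
    rw [Real.sqrt_le_left (norm_nonneg _), div_le_iff₀' hSpos, ← hBsum c hc]
    refine le_trans ?_ (norm_sq_le_norm_inverse_gram_mul hS _)
    have := infDist_affineSpan_ne_le_norm_sum ξ i₀ hc hci
    rw [hahat i₀] at this
    gcongr
  have hapos : 0 < a ^ 2 := lt_of_lt_of_le (by positivity) hlow
  refine ⟨?_, norm_inverse_gram_le hS (by positivity) fun v => ?_⟩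
  · rw [div_le_iff₀ hapos, mul_comm]
    rwa [div_le_iff₀ hSpos] at hlow
  · obtain ⟨c, hc, rfl⟩ := hspan v
    rw [hBsum c hc, norm_sq_sum_smul_of_equilateral hh hc]
    have hcoef : ∀ i, c i ^ 2 ≤ ‖∑ j, c j • y j‖ ^ 2 / a ^ 2 := by
      intro i
      rw [le_div_iff₀ hapos, ← sq_abs (c i), ← mul_pow]
      gcongr
      exact (mul_le_mul_of_nonneg_left (hale i) (abs_nonneg _)).trans
        (abs_mul_infDist_affineSpan_ne_le y i hc)
    have hcoefs : ∑ i, c i ^ 2 ≤ (n + 1) * (‖∑ j, c j • y j‖ ^ 2 / a ^ 2) := by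
      simpa using Finset.sum_le_sum fun i (_ : i ∈ Finset.univ) => hcoef i
    have hn1 : (n : ℝ) * ahat ^ 2 ≤ n ^ 2 * ahat ^ 2 := by
      have : (1 : ℝ) ≤ n := by exact_mod_cast hn
      gcongr
      nlinarith
    calc h ^ 2 / 2 * ∑ j, c j ^ 2
        ≤ h ^ 2 / 2 * ((n + 1) * (‖∑ j, c j • y j‖ ^ 2 / a ^ 2)) := by gcongr
      _ = (n + 1) * (h ^ 2 / 2) * (‖∑ j, c j • y j‖ ^ 2 / a ^ 2) := by ring
      _ ≤ n ^ 2 * ahat ^ 2 * (‖∑ j, c j • y j‖ ^ 2 / a ^ 2) := by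
        exact mul_le_mul_of_nonneg_right (hedge.trans hn1) (by positivity)
      _ = n ^ 2 * ahat ^ 2 / a ^ 2 * ‖∑ j, c j • y j‖ ^ 2 := by ring
end

section
/- Let d ≥ 2, N ≥ 1, τ > 0, let I : (ℝ^d)^N → ℝ be differentiable, and let x : ℝ → (ℝ^d)^N be differentiable. Suppose there are functions P_i : ℝ → (0,∞) and ν_i : ℝ → ℝ^d with ‖ν_i(t)‖ = 1 for all t and i, such that for every t and every i = 1, …, N the i-th component satisfies x_i'(t) = −(P_i(t)/τ) [ g_i(t) − (g_i(t)·ν_i(t)) ν_i(t) ], where g_i(t) ∈ ℝ^d is the partial gradient of I with respect to the i-th block variable evaluated at x(t). Then the function t ↦ I(x(t)) is nonincreasing; in fact its derivative equals −Σ_i (P_i(t)/τ)[ ‖g_i(t)‖² − (g_i(t)·ν_i(t))² ] ≤ 0 at every t. -/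
open scoped RealInnerProductSpace

/-- The partial gradient of `f` in the `i`-th block represents the restriction of the Fréchet
derivative to that block. -/
theorem inner_gradient_comp_update {ι E : Type*} [Fintype ι] [DecidableEq ι]
    [NormedAddCommGroup E] [InnerProductSpace ℝ E] [CompleteSpace E]
    {f : (ι → E) → ℝ} {z : ι → E} (hf : DifferentiableAt ℝ f z) (i : ι) (v : E) :
    ⟪gradient (fun y => f (Function.update z i y)) (z i), v⟫ = fderiv ℝ f z (Pi.single i v) := by
  have hf' : HasFDerivAt f (fderiv ℝ f z) (Function.update z i (z i)) := by
    simpa using hf.hasFDerivAt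
  have h := hf'.comp (z i) (hasFDerivAt_update (𝕜 := ℝ) z (i := i) (z i))
  have h' : fderiv ℝ (fun y => f (Function.update z i y)) (z i) = _ := h.fderiv
  rw [gradient, InnerProductSpace.toDual_symm_apply, h', ContinuousLinearMap.comp_apply]
  congr 1
  ext1 j
  rcases eq_or_ne j i with rfl | hj
  · simp
  · simp [hj]

/-- The Fréchet derivative of a function of several blocks is the sum of the pairings with the
partial gradients. -/
theorem fderiv_eq_sum_inner_gradient_comp_update {ι E : Type*} [Fintype ι] [DecidableEq ι]
    [NormedAddCommGroup E] [InnerProductSpace ℝ E] [CompleteSpace E]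
    {f : (ι → E) → ℝ} {z : ι → E} (hf : DifferentiableAt ℝ f z) (v : ι → E) :
    fderiv ℝ f z v
      = ∑ i, ⟪gradient (fun y => f (Function.update z i y)) (z i), v i⟫ := by
  simp_rw [inner_gradient_comp_update hf]
  rw [← map_sum, Finset.univ_sum_single]

/-- Along the projected-gradient surface moving mesh flow
`x_i'(t) = −(P_i(t)/τ)[g_i(t) − (g_i(t)·ν_i(t))ν_i(t)]`, where `g_i(t)` is the partial
gradient of the meshing energy `I` with respect to the `i`-th block at `x(t)` and
`ν_i(t)` are unit vectors, the energy `t ↦ I(x(t))` is nonincreasing; its derivative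
equals `−Σ_i (P_i(t)/τ)[‖g_i(t)‖² − (g_i(t)·ν_i(t))²] ≤ 0`. -/
theorem energy_decreasing (d N : ℕ) (hd : 2 ≤ d) (hN : 1 ≤ N)
    (τ : ℝ) (hτ : 0 < τ)
    (I : (Fin N → EuclideanSpace ℝ (Fin d)) → ℝ) (hI : Differentiable ℝ I)
    (x : ℝ → Fin N → EuclideanSpace ℝ (Fin d)) (hx : Differentiable ℝ x)
    (P : Fin N → ℝ → ℝ) (hP : ∀ i t, 0 < P i t)
    (ν : Fin N → ℝ → EuclideanSpace ℝ (Fin d)) (hν : ∀ i t, ‖ν i t‖ = 1)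
    (g : Fin N → ℝ → EuclideanSpace ℝ (Fin d))
    (hg : ∀ i t, g i t = gradient (fun y => I (Function.update (x t) i y)) (x t i))
    (hode : ∀ t (i : Fin N),
      deriv x t i = (-(P i t / τ)) • (g i t - ⟪g i t, ν i t⟫ • ν i t)) :
    Antitone (fun t => I (x t)) ∧
      ∀ t, deriv (fun s => I (x s)) t
          = -(∑ i, (P i t / τ) * (‖g i t‖ ^ 2 - ⟪g i t, ν i t⟫ ^ 2)) ∧
        -(∑ i, (P i t / τ) * (‖g i t‖ ^ 2 - ⟪g i t, ν i t⟫ ^ 2)) ≤ 0 := by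
  have hderiv : ∀ t, deriv (fun s => I (x s)) t
      = -(∑ i, (P i t / τ) * (‖g i t‖ ^ 2 - ⟪g i t, ν i t⟫ ^ 2)) := by
    intro t
    have h : deriv (fun s => I (x s)) t = fderiv ℝ I (x t) (deriv x t) :=
      ((hI (x t)).hasFDerivAt.comp_hasDerivAt t (hx t).hasDerivAt).deriv
    rw [h, fderiv_eq_sum_inner_gradient_comp_update (hI (x t)), ← Finset.sum_neg_distrib]
    refine Finset.sum_congr rfl fun i _ => ?_
    rw [← hg, hode, inner_smul_right, inner_sub_right, inner_smul_right,
      real_inner_self_eq_norm_sq]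
    ring
  have hnonpos : ∀ t, -(∑ i, (P i t / τ) * (‖g i t‖ ^ 2 - ⟪g i t, ν i t⟫ ^ 2)) ≤ 0 := by
    intro t
    refine neg_nonpos.2 (Finset.sum_nonneg fun i _ => ?_)
    refine mul_nonneg (div_pos (hP i t) hτ).le (sub_nonneg.2 (sq_le_sq.2 ?_))
    simpa [hν i t] using abs_real_inner_le_norm (g i t) (ν i t)
  exact ⟨antitone_of_deriv_nonpos (hI.comp hx) fun t => (hderiv t).trans_le (hnonpos t),
    fun t => ⟨hderiv t, hnonpos t⟩⟩
end

section
/- Let d ≥ 2, N ≥ 1, τ > 0. Let I : (ℝ^d)^N → ℝ be continuously differentiable, let P_i : (ℝ^d)^N → (0,∞) be continuous, and let ν_i : (ℝ^d)^N → ℝ^d be continuous with ‖ν_i(y)‖ = 1 for all y. Define F : (ℝ^d)^N → (ℝ^d)^N componentwise by F_i(y) = −(P_i(y)/τ)[ g_i(y) − (g_i(y)·ν_i(y)) ν_i(y) ], where g_i(y) is the partial gradient of I with respect to the i-th block at y. If x : [0,∞) → (ℝ^d)^N is differentiable, satisfies x'(t) = F(x(t)) for all t ≥ 0, and x(t) →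 x* as t → ∞, then the limit is a critical point of the projected system: for every i, g_i(x*) − (g_i(x*)·ν_i(x*)) ν_i(x*) = 0. -/
open scoped RealInnerProductSpace
open Filter

/-- If a curve converges at infinity and its derivative has a limit there, that limit is zero. -/
theorem eq_zero_of_tendsto_of_tendsto_hasDerivAt {E : Type*} [NormedAddCommGroup E]
    [NormedSpace ℝ E] {f f' : ℝ → E} {a L : E} (hf : ∀ᶠ t in atTop, HasDerivAt f (f' t) t)
    (ha : Tendsto f atTop (nhds a)) (hL : Tendsto f' atTop (nhds L)) : L = 0 := by
  have hstep : Tendsto (fun t => f (t + 1) - f t) atTop (nhds 0) := by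
    simpa using (ha.comp (tendsto_atTop_add_const_right atTop (1 : ℝ) tendsto_id)).sub ha
  refine tendsto_nhds_unique (Metric.tendsto_nhds.2 fun ε hε => ?_) hstep
  obtain ⟨T, hT⟩ := eventually_atTop.1
    (hf.and (Metric.tendsto_nhds.1 hL (ε / 2) (half_pos hε)))
  filter_upwards [eventually_ge_atTop T] with t ht
  have hderiv : ∀ s ∈ Set.Icc t (t + 1),
      HasDerivWithinAt (fun s => f s - s • L) (f' s - L) (Set.Icc t (t + 1)) s := by
    intro s hs
    have hlin : HasDerivAt (fun s : ℝ => s • L) L s := by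
      simpa using (hasDerivAt_id s).smul_const L
    exact ((hT s (ht.trans hs.1)).1.sub hlin).hasDerivWithinAt
  have hbound : ∀ s ∈ Set.Icc t (t + 1), ‖f' s - L‖ ≤ ε / 2 := by
    intro s hs
    rw [← dist_eq_norm]
    exact (hT s (ht.trans hs.1)).2.le
  have hmv := (convex_Icc t (t + 1)).norm_image_sub_le_of_norm_hasDerivWithin_le hderiv hbound
    (Set.left_mem_Icc.2 (by linarith)) (Set.right_mem_Icc.2 (by linarith))
  have hrw : f (t + 1) - (t + 1) • L - (f t - t • L) = f (t + 1) - f t - L := by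
    rw [add_smul, one_smul]
    abel
  rw [hrw, add_sub_cancel_left, norm_one, mul_one] at hmv
  rw [dist_eq_norm]
  linarith

/-- The partial gradients of a continuously differentiable function are continuous. -/
theorem ContDiff.continuous_gradient_update {ι E : Type*} [Fintype ι] [DecidableEq ι]
    [NormedAddCommGroup E] [InnerProductSpace ℝ E] [CompleteSpace E] {I : (ι → E) → ℝ}
    (hI : ContDiff ℝ 1 I) (i : ι) :
    Continuous fun y : ι → E => gradient (fun z => I (Function.update y i z)) (y i) := by
  have hpartial : ∀ y : ι → E, fderiv ℝ (fun z => I (Function.update y i z)) (y i) =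
      (fderiv ℝ I y).comp (ContinuousLinearMap.pi (Pi.single i (.id ℝ E))) := by
    intro y
    have hIy : HasFDerivAt I (fderiv ℝ I y) (Function.update y i (y i)) := by
      rw [Function.update_eq_self]
      exact (hI.differentiable one_ne_zero y).hasFDerivAt
    exact (hIy.comp (y i) (hasFDerivAt_update y (y i))).fderiv
  simp only [gradient, hpartial]
  exact (InnerProductSpace.toDual ℝ E).symm.continuous.comp
    ((hI.continuous_fderiv one_ne_zero).clm_comp continuous_const)

/-- If a trajectory of the autonomous projected-gradient surface moving
mesh system `x'(t) = F(x(t))`, with continuously differentiable energy `I`, continuous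
positive `P_i`, continuous unit normals `ν_i`, and
`F_i(y) = −(P_i(y)/τ)[g_i(y) − (g_i(y)·ν_i(y))ν_i(y)]`, converges to `x*` as `t → ∞`, then
`x*` is a critical point of the projected system: the projected gradient vanishes at `x*`. -/
theorem limit_mesh_is_critical_point (d N : ℕ) (hd : 2 ≤ d) (hN : 1 ≤ N)
    (τ : ℝ) (hτ : 0 < τ)
    (I : (Fin N → EuclideanSpace ℝ (Fin d)) → ℝ) (hI : ContDiff ℝ 1 I)
    (P : Fin N → (Fin N → EuclideanSpace ℝ (Fin d)) → ℝ)
    (hPcont : ∀ i, Continuous (P i)) (hPpos : ∀ i y, 0 < P i y)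
    (ν : Fin N → (Fin N → EuclideanSpace ℝ (Fin d)) → EuclideanSpace ℝ (Fin d))
    (hνcont : ∀ i, Continuous (ν i)) (hν : ∀ i y, ‖ν i y‖ = 1)
    (g : Fin N → (Fin N → EuclideanSpace ℝ (Fin d)) → EuclideanSpace ℝ (Fin d))
    (hg : ∀ i y, g i y = gradient (fun z => I (Function.update y i z)) (y i))
    (F : (Fin N → EuclideanSpace ℝ (Fin d)) → Fin N → EuclideanSpace ℝ (Fin d))
    (hF : ∀ y i, F y i = (-(P i y / τ)) • (g i y - ⟪g i y, ν i y⟫ • ν i y))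
    (x : ℝ → Fin N → EuclideanSpace ℝ (Fin d))
    (hode : ∀ t : ℝ, 0 ≤ t → HasDerivAt x (F (x t)) t)
    (xstar : Fin N → EuclideanSpace ℝ (Fin d))
    (hconv : Tendsto x atTop (nhds xstar)) :
    ∀ i, g i xstar - ⟪g i xstar, ν i xstar⟫ • ν i xstar = 0 := by
  have hgcont : ∀ i, Continuous (g i) := by
    intro i
    rw [funext (hg i)]
    exact hI.continuous_gradient_update i
  have hFcont : Continuous F := by
    refine continuous_pi fun i => ?_
    simp only [hF]
    have := hPcont i
    have := hνcont i
    have := hgcont i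
    fun_prop
  have hFzero : F xstar = 0 :=
    eq_zero_of_tendsto_of_tendsto_hasDerivAt ((eventually_ge_atTop 0).mono hode) hconv
      ((hFcont.tendsto xstar).comp hconv)
  intro i
  have hi := hF xstar i
  rw [hFzero, Pi.zero_apply] at hi
  exact (smul_eq_zero.1 hi.symm).resolve_left
    (neg_ne_zero.2 (div_pos (hPpos i xstar) hτ).ne')
end

section
/- Let d ≥ 2, let E : ℝ → ℝ^{d×(d−1)} be differentiable at t₀ with derivative E'(t₀), let M ∈ ℝ^{d×d} be symmetric, let S ∈ ℝ^{(d−1)×(d−1)} be symmetric, let Ê ∈ ℝ^{(d−1)×(d−1)} be invertible, and suppose B(t₀) is invertible, where B(t) = E(t)ᵀ M E(t). Then the function f(t) = tr(S Ê B(t)⁻¹ Êᵀ) is differentiable at t₀ with f'(t₀) = −2 tr( B⁻¹ Êᵀ S Ê B⁻¹ Eᵀ M E'(t₀) ), where B, E on the right-hand side are evaluated at t₀. -/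
open Matrix

open scoped Matrix.Norms.Operator in
/-- Entrywise differentiability of the inverse of a matrix-valued function. -/
theorem hasDerivAt_matrix_inv_apply {m : Type*} [Fintype m] [DecidableEq m]
    {B : ℝ → Matrix m m ℝ} {B' : Matrix m m ℝ} {t₀ : ℝ}
    (h : ∀ i j, HasDerivAt (fun t => B t i j) (B' i j) t₀) (hB : IsUnit (B t₀).det) (i j : m) :
    HasDerivAt (fun t => (B t)⁻¹ i j) ((-((B t₀)⁻¹ * B' * (B t₀)⁻¹)) i j) t₀ := by
  have : CompleteSpace (Matrix m m ℝ) := FiniteDimensional.complete ℝ _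
  have hd : HasDerivAt B B' t₀ := hasDerivAt_pi.2 fun i => hasDerivAt_pi.2 (h i)
  obtain ⟨u, hu⟩ := (Matrix.isUnit_iff_isUnit_det _).2 hB
  have hi := hasFDerivAt_ringInverse (𝕜 := ℝ) u
  rw [hu] at hi
  have hc := hi.comp_hasDerivAt t₀ hd
  have hv : (↑u⁻¹ : Matrix m m ℝ) = (B t₀)⁻¹ := by rw [← hu, Matrix.coe_units_inv]
  simp only [_root_.neg_apply, ContinuousLinearMap.mulLeftRight_apply, hv] at hc
  have he := hasDerivAt_pi.1 (hasDerivAt_pi.1 hc i) j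
  simpa only [Function.comp_apply, Matrix.nonsing_inv_eq_ringInverse] using he

/-- Product rule for entrywise differentiable matrix-valued functions. -/
theorem hasDerivAt_matrix_mul_apply {l m n : Type*} [Fintype m]
    {A : ℝ → Matrix l m ℝ} {A' : Matrix l m ℝ} {B : ℝ → Matrix m n ℝ} {B' : Matrix m n ℝ} {t₀ : ℝ}
    (hA : ∀ i j, HasDerivAt (fun t => A t i j) (A' i j) t₀)
    (hB : ∀ i j, HasDerivAt (fun t => B t i j) (B' i j) t₀) (i : l) (j : n) :
    HasDerivAt (fun t => (A t * B t) i j) ((A' * B t₀ + A t₀ * B') i j) t₀ := by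
  simp only [Matrix.add_apply, Matrix.mul_apply, ← Finset.sum_add_distrib]
  exact HasDerivAt.fun_sum fun k _ => (hA i k).mul (hB k j)

/-- Derivative of the alignment part of the meshing function: with
`B(t) = E(t)ᵀ M E(t)` invertible at `t₀`, `M` and `S` symmetric, `Ê` invertible, the
function `f(t) = tr(S Ê B(t)⁻¹ Êᵀ)` is differentiable at `t₀` with
`f'(t₀) = −2 tr(B⁻¹ Êᵀ S Ê B⁻¹ Eᵀ M E'(t₀))` (right-hand side evaluated at `t₀`). -/
theorem deriv_trace_alignment (n : ℕ) (hn : 1 ≤ n)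
    (E : ℝ → Matrix (Fin (n + 1)) (Fin n) ℝ)
    (E' : Matrix (Fin (n + 1)) (Fin n) ℝ) (t₀ : ℝ)
    (hE : ∀ i j, HasDerivAt (fun t => E t i j) (E' i j) t₀)
    (M : Matrix (Fin (n + 1)) (Fin (n + 1)) ℝ) (hM : M.IsSymm)
    (S : Matrix (Fin n) (Fin n) ℝ) (hS : S.IsSymm)
    (Ehat : Matrix (Fin n) (Fin n) ℝ) (hEhat : IsUnit Ehat.det)
    (hB : IsUnit ((E t₀)ᵀ * M * E t₀).det) :
    HasDerivAt (fun t => (S * Ehat * ((E t)ᵀ * M * E t)⁻¹ * Ehatᵀ).trace)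
      (-2 * (((E t₀)ᵀ * M * E t₀)⁻¹ * Ehatᵀ * S * Ehat * ((E t₀)ᵀ * M * E t₀)⁻¹ *
        (E t₀)ᵀ * M * E').trace) t₀ := by
  have const {l m : Type} (C : Matrix l m ℝ) (i : l) (j : m) :
      HasDerivAt (fun _ : ℝ => C i j) ((0 : Matrix l m ℝ) i j) t₀ := hasDerivAt_const _ _
  have hEt : ∀ i j, HasDerivAt (fun t => (E t)ᵀ i j) (E'ᵀ i j) t₀ := fun i j => hE j i
  have hBd := hasDerivAt_matrix_mul_apply (hasDerivAt_matrix_mul_apply hEt (const M)) hE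
  have hf := hasDerivAt_matrix_mul_apply (hasDerivAt_matrix_mul_apply (const (S * Ehat))
    (hasDerivAt_matrix_inv_apply hBd hB)) (const Ehatᵀ)
  have htr := HasDerivAt.fun_sum (u := Finset.univ) fun i _ => hf i i
  refine htr.congr_deriv ?_
  change Matrix.trace _ = _
  simp only [Matrix.mul_zero, Matrix.zero_mul, add_zero, zero_add]
  have hBt : (((E t₀)ᵀ * M * E t₀)⁻¹)ᵀ = ((E t₀)ᵀ * M * E t₀)⁻¹ := by
    rw [Matrix.transpose_nonsing_inv]
    simp [Matrix.transpose_mul, hM.eq, Matrix.mul_assoc]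
  generalize ((E t₀)ᵀ * M * E t₀)⁻¹ = C at hBt ⊢
  have hleft : (S * Ehat * (C * (E'ᵀ * M * E t₀) * C) * Ehatᵀ).trace =
      (C * Ehatᵀ * S * Ehat * C * (E t₀)ᵀ * M * E').trace := by
    rw [← Matrix.trace_transpose]
    simp only [Matrix.transpose_mul, Matrix.transpose_transpose, hM.eq, hS.eq, hBt]
    rw [show Ehat * (C * ((E t₀)ᵀ * (M * E') * C) * (Ehatᵀ * S)) =
      (Ehat * C * (E t₀)ᵀ * M * E') * (C * Ehatᵀ * S) by simp only [Matrix.mul_assoc],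
      Matrix.trace_mul_comm]
    simp only [Matrix.mul_assoc]
  have hright : (S * Ehat * (C * ((E t₀)ᵀ * M * E') * C) * Ehatᵀ).trace =
      (C * Ehatᵀ * S * Ehat * C * (E t₀)ᵀ * M * E').trace := by
    rw [show S * Ehat * (C * ((E t₀)ᵀ * M * E') * C) * Ehatᵀ =
      (S * Ehat * C * (E t₀)ᵀ * M * E') * (C * Ehatᵀ) by simp only [Matrix.mul_assoc],
      Matrix.trace_mul_comm]
    simp only [Matrix.mul_assoc]
  rw [Matrix.mul_neg, Matrix.neg_mul, Matrix.trace_neg, Matrix.mul_add, Matrix.add_mul,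
    Matrix.mul_add, Matrix.add_mul, Matrix.trace_add, hleft, hright]
  ring
end
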